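/- Let k ≥ 2 and let f_1,…,f_k and g_1,…,g_{k+1} be nonzero homogeneous polynomials in ℂ[x_0,…,x_{k+3}] of positive degrees, with deg f_1 ≤ … ≤ deg f_k and deg g_1 ≤ … ≤ deg g_{k+1}. Assume: (i) ⟨f_1,…,f_k⟩ ⊆ ⟨g_1,…,g_{k+1}⟩; (ii) the projective variety X = V(f_1,…,f_k) has dimension 3 and only finitely many singular points; (iii) S = V(g_1,…,g_{k+1}) is a smooth surface, i.e. has dimension 2 and the Jacobian matrix of (g_1,…,g_{k+1}) has rank k+1 at every nonzero point of the affine cone over S; (iv) for every s ≤ k−1 the variety V(f_1,…,f_s) is smooth in codimension 3. If deg f_i < deg g_{i+2} for some integer i ≤ k−1, then (deg f_1,…,deg f_i) is a subsequence of (deg g_1,…,deg g_{i+1}). -/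

import Mathlib

noncomputable section
open MvPolynomial

/-- The Jacobian matrix of the family `p 1, …, p m` of polynomials in the variables
`x_0, …, x_n`, evaluated at the point `x` of the affine cone `ℂ^{n+1}`. -/
def jacobianAt (n m : ℕ) (p : ℕ → MvPolynomial (Fin (n + 1)) ℂ) (x : Fin (n + 1) → ℂ) :
    Matrix (Fin m) (Fin (n + 1)) ℂ :=
  Matrix.of fun l j => eval x (pderiv j (p (l.1 + 1)))

/-- `x` is a nonzero point of the affine cone over `V(p_1,…,p_m)` at which the
Jacobian matrix has rank `< m`; i.e. `x` represents a singular point of `V(p_1,…,p_m)`. -/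
def SingularConePt (n m : ℕ) (p : ℕ → MvPolynomial (Fin (n + 1)) ℂ)
    (x : Fin (n + 1) → ℂ) : Prop :=
  x ≠ 0 ∧ (∀ l, 1 ≤ l → l ≤ m → eval x (p l) = 0) ∧ (jacobianAt n m p x).rank < m

/-- The set of singular points of `V(p_1,…,p_m)` in projective space `P^n(ℂ)`. -/
def projSingularLocus (n m : ℕ) (p : ℕ → MvPolynomial (Fin (n + 1)) ℂ) :
    Set (Projectivization ℂ (Fin (n + 1) → ℂ)) :=
  {P | ∃ x, ∃ hx : x ≠ 0, SingularConePt n m p x ∧ P = Projectivization.mk ℂ x hx}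

/-- The ideal generated by `p_1,…,p_m` together with all `m × m` minors of the
Jacobian matrix; its projective zero locus is the singular locus of `V(p_1,…,p_m)`. -/
def singularIdeal (n m : ℕ) (p : ℕ → MvPolynomial (Fin (n + 1)) ℂ) :
    Ideal (MvPolynomial (Fin (n + 1)) ℂ) :=
  Ideal.span ((fun i => p i) '' Set.Icc 1 m ∪
    {q | ∃ c : Fin m → Fin (n + 1),
      q = (Matrix.of fun l l' : Fin m => pderiv (c l') (p (l.1 + 1))).det})

/-- `V(p_1,…,p_m) ⊂ P^n(ℂ)` is smooth in codimension 3: its singular locus, as a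
projective algebraic set, has dimension at most `dim V(p_1,…,p_m) − 4`.  This is
expressed via Krull dimensions of the homogeneous coordinate rings (the projective
dimension being the Krull dimension of the affine cone minus 1). -/
def SmoothInCodimThree (n m : ℕ) (p : ℕ → MvPolynomial (Fin (n + 1)) ℂ) : Prop :=
  ringKrullDim (MvPolynomial (Fin (n + 1)) ℂ ⧸ singularIdeal n m p) + 4 ≤
    ringKrullDim (MvPolynomial (Fin (n + 1)) ℂ ⧸
      Ideal.span ((fun i => p i) '' Set.Icc 1 m))

theorem mvPolynomial_height_of_isMaximal {K : Type*} [Field K] (n : ℕ)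
    (M : Ideal (MvPolynomial (Fin n) K)) [M.IsMaximal] : M.height = n := by
  induction n with
  | zero =>
    have h := Ideal.height_le_ringKrullDim_of_isPrime (I := M)
    simp only [ringKrullDim_mvPolynomial_of_isEmpty, ringKrullDim_eq_zero_of_field] at h
    simpa using h
  | succ n ih =>
    let e : MvPolynomial (Fin (n + 1)) K ≃+* Polynomial (MvPolynomial (Fin n) K) :=
      (finSuccEquiv K n).toRingEquiv
    rw [← e.height_map M]
    have : (M.map e).IsMaximal := Ideal.map_isMaximal_of_equiv e
    have : ((M.map e).comap Polynomial.C).IsMaximal :=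
      Polynomial.isMaximal_comap_C_of_isJacobsonRing _
    have : (M.map e).LiesOver ((M.map e).comap Polynomial.C) := ⟨rfl⟩
    rw [Polynomial.height_eq_height_add_one ((M.map e).comap Polynomial.C), ih]
    simp

theorem ringKrullDim_le_of_isIntegral {R S : Type*} [CommRing R] [CommRing S] [Algebra R S]
    [Algebra.IsIntegral R S] : ringKrullDim S ≤ ringKrullDim R :=
  Order.krullDim_le_of_strictMono (PrimeSpectrum.comap (algebraMap R S))
    fun _ _ h ↦ Ideal.IsIntegral.comap_lt_comap h

theorem ringKrullDim_le_height_of_isDomain (K : Type*) {B : Type*} [Field K] [CommRing B]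
    [IsDomain B] [Algebra K B] [Algebra.FiniteType K B] (M : Ideal B) [M.IsMaximal] :
    ringKrullDim B ≤ M.height := by
  obtain ⟨s, g, hg, hfin⟩ := exists_finite_inj_algHom_of_fg K B
  algebraize [g.toRingHom]
  have : FaithfulSMul (MvPolynomial (Fin s) K) B :=
    (faithfulSMul_iff_algebraMap_injective _ _).mpr hg
  have : IsNoetherianRing B := Algebra.FiniteType.isNoetherianRing K B
  have : Algebra.IsIntegral (MvPolynomial (Fin s) K) B := ⟨hfin.to_isIntegral⟩
  have : (M.under (MvPolynomial (Fin s) K)).IsMaximal :=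
    Ideal.isMaximal_comap_of_isIntegral_of_isMaximal M
  have h := Ideal.height_eq_height_add_of_liesOver_of_hasGoingDown
    (M.under (MvPolynomial (Fin s) K)) M
  rw [mvPolynomial_height_of_isMaximal] at h
  calc ringKrullDim B ≤ ringKrullDim (MvPolynomial (Fin s) K) := ringKrullDim_le_of_isIntegral
    _ = (s : ℕ∞) := by simp
    _ ≤ M.height := by rw [h]; exact_mod_cast le_self_add

theorem Ideal.height_map_quotientMk_le {R : Type*} [CommRing R] {I p : Ideal R} [p.IsPrime]
    (h : I ≤ p) : (p.map (Ideal.Quotient.mk I)).height ≤ p.height := by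
  have hp : (p.map (Ideal.Quotient.mk I)).IsPrime := isPrime_map_quotientMk_of_isPrime h
  have hmono : StrictMono (PrimeSpectrum.comap (Ideal.Quotient.mk I)) :=
    Monotone.strictMono_of_injective (fun _ _ h ↦ Ideal.comap_mono h)
      (PrimeSpectrum.comap_injective_of_surjective _ Ideal.Quotient.mk_surjective)
  have hcomap : PrimeSpectrum.comap (Ideal.Quotient.mk I) ⟨_, hp⟩ = ⟨p, inferInstance⟩ := by
    ext1
    exact (Ideal.comap_map_quotientMk I p).trans (sup_eq_right.mpr h)
  have := Order.height_le_height_apply_of_strictMono _ hmono ⟨_, hp⟩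
  rwa [hcomap, ← PrimeSpectrum.height_eq_orderHeight, ← PrimeSpectrum.height_eq_orderHeight] at this

theorem ringKrullDim_le_height_of_minimalPrimes_le (K : Type*) {A : Type*} [Field K] [CommRing A]
    [Algebra K A] [Algebra.FiniteType K A] (M : Ideal A) [M.IsMaximal]
    (hM : ∀ p ∈ minimalPrimes A, p ≤ M) : ringKrullDim A ≤ M.height := by
  rw [ringKrullDim, Order.krullDim_eq_iSup_coheight]
  refine iSup_le fun q ↦ ?_
  obtain ⟨p, hp, hpq⟩ := Ideal.exists_minimalPrimes_le (bot_le : ⊥ ≤ q.asIdeal)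
  have := hp.isPrime
  have hpM := hM p hp
  have : (M.map (Ideal.Quotient.mk p)).IsMaximal :=
    .map_of_surjective_of_ker_le Ideal.Quotient.mk_surjective (by simpa using hpM)
  calc (Order.coheight q : WithBot ℕ∞) ≤ Order.coheight (⟨p, hp.isPrime⟩ : PrimeSpectrum A) := by
        exact WithBot.coe_le_coe.mpr (Order.coheight_anti hpq)
    _ = ringKrullDim (A ⧸ p) := by
        rw [Order.coheight_eq_krullDim_Ici, ringKrullDim_quotient]
        rfl
    _ ≤ (M.map (Ideal.Quotient.mk p)).height := ringKrullDim_le_height_of_isDomain K _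
    _ ≤ M.height := by exact_mod_cast Ideal.height_map_quotientMk_le hpM

/-- The ideal generated by the maximal minors of a matrix with `m` rows, the columns of a minor
being chosen with repetitions allowed. -/
def Matrix.maximalMinors {A : Type*} [CommRing A] {m n : ℕ} (H : Matrix (Fin m) (Fin n) A) :
    Ideal A :=
  Ideal.span (Set.range fun c : Fin m → Fin n ↦ (H.submatrix id c).det)

namespace Matrix

variable {A B : Type*} [CommRing A] [CommRing B] {m n : ℕ}

theorem maximalMinors_le_iff {H : Matrix (Fin m) (Fin n) A} {I : Ideal A} :
    H.maximalMinors ≤ I ↔ ∀ c : Fin m → Fin n, (H.submatrix id c).det ∈ I := by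
  rw [maximalMinors, Ideal.span_le, Set.range_subset_iff]
  rfl

theorem det_submatrix_mem_maximalMinors (H : Matrix (Fin m) (Fin n) A) (c : Fin m → Fin n) :
    (H.submatrix id c).det ∈ H.maximalMinors :=
  Ideal.subset_span ⟨c, rfl⟩

theorem maximalMinors_map (φ : A →+* B) (H : Matrix (Fin m) (Fin n) A) :
    (H.map φ).maximalMinors = H.maximalMinors.map φ := by
  rw [maximalMinors, maximalMinors, Ideal.map_span, ← Set.range_comp]
  congr 2
  ext c
  simp [RingHom.map_det, submatrix_map]

theorem det_mul_mem_maximalMinors (H : Matrix (Fin m) (Fin n) A) (G : Matrix (Fin n) (Fin m) A) :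
    (H * G).det ∈ H.maximalMinors := by
  have h : (H * G)ᵀ = of fun c ↦ ∑ j, G j c • fun l ↦ H l j := by
    ext c l
    simp [mul_apply, mul_comm]
  have hdet : (H * G).det = ∑ φ : Fin m → Fin n, (∏ c, G (φ c) c) • (H.submatrix id φ).det := by
    rw [← det_transpose, h]
    change detRowAlternating.toMultilinearMap (fun c ↦ ∑ j, G j c • fun l ↦ H l j) = _
    rw [MultilinearMap.map_sum]
    refine Finset.sum_congr rfl fun φ _ ↦ ?_
    rw [MultilinearMap.map_smul_univ, ← det_transpose (H.submatrix id φ)]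
    rfl
  rw [hdet]
  exact sum_mem fun φ _ ↦ Ideal.mul_mem_left _ _ (H.det_submatrix_mem_maximalMinors φ)

theorem exists_det_submatrix_ne_zero_of_linearIndependent {K : Type*} [Field K]
    {H : Matrix (Fin m) (Fin n) K} (h : LinearIndependent K H.row) :
    ∃ c : Fin m → Fin n, (H.submatrix id c).det ≠ 0 := by
  have hrank : Module.finrank K (Submodule.span K (Set.range H.col)) = m := by
    rw [← rank_eq_finrank_span_cols, h.rank_matrix, Fintype.card_fin]
  obtain ⟨f, hf, -, hli⟩ := Submodule.exists_fun_fin_finrank_span_eq K (Set.range H.col)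
  choose c hc using hf
  refine ⟨c ∘ Fin.cast hrank.symm, ?_⟩
  rw [← isUnit_iff_ne_zero, ← isUnit_iff_isUnit_det, ← linearIndependent_cols_iff_isUnit]
  have hcol : (H.submatrix id (c ∘ Fin.cast hrank.symm)).col = f ∘ Fin.cast hrank.symm := by
    ext a b
    exact congrFun (hc _) b
  rw [hcol]
  exact hli.comp _ (Fin.cast_injective hrank.symm)

theorem exists_vecMul_eq_zero_of_maximalMinors_eq_bot [IsDomain A] {H : Matrix (Fin m) (Fin n) A}
    (h : H.maximalMinors = ⊥) : ∃ v ≠ 0, v ᵥ* H = 0 := by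
  by_contra! hv
  let K := FractionRing A
  have hli : LinearIndependent A H.row := by
    rw [Fintype.linearIndependent_iff]
    intro v hvH
    have : v = 0 := by
      by_contra hne
      refine hv v hne ?_
      rw [← hvH]
      ext j
      simp [vecMul, dotProduct, row]
    simp [this]
  have hinj : LinearMap.ker ((Algebra.linearMap A K).compLeft (Fin n)) = ⊥ :=
    LinearMap.ker_eq_bot.mpr fun x y hxy ↦ funext fun j ↦
      IsFractionRing.injective A K (congrFun hxy j)
  have hliK : LinearIndependent K (H.map (algebraMap A K)).row :=
    (LinearIndependent.iff_fractionRing A K).mp (hli.map' _ hinj)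
  obtain ⟨c, hc⟩ := exists_det_submatrix_ne_zero_of_linearIndependent hliK
  have h0 : (H.submatrix id c).det = 0 := by
    simpa [h] using H.det_submatrix_mem_maximalMinors c
  rw [submatrix_map, ← RingHom.mapMatrix_apply, ← RingHom.map_det, h0, map_zero] at hc
  exact hc rfl

theorem maximalMinors_le_iff_exists {Q : Ideal A} [Q.IsPrime] {H : Matrix (Fin m) (Fin n) A} :
    H.maximalMinors ≤ Q ↔ ∃ v : Fin m → A, (∃ a, v a ∉ Q) ∧ ∀ b, ∑ a, v a * H a b ∈ Q := by
  constructor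
  · intro h
    have hbot : (H.map (Ideal.Quotient.mk Q)).maximalMinors = ⊥ := by
      rw [maximalMinors_map, Ideal.map_eq_bot_iff_le_ker, Ideal.mk_ker]
      exact h
    obtain ⟨v, hv, hvH⟩ := exists_vecMul_eq_zero_of_maximalMinors_eq_bot hbot
    choose w hw using fun a ↦ Ideal.Quotient.mk_surjective (I := Q) (v a)
    refine ⟨w, ?_, fun b ↦ ?_⟩
    · obtain ⟨a, ha⟩ := Function.ne_iff.mp hv
      exact ⟨a, by rwa [← Ideal.Quotient.eq_zero_iff_mem, hw]⟩
    · rw [← Ideal.Quotient.eq_zero_iff_mem, map_sum]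
      simpa [vecMul, dotProduct, hw] using congrFun hvH b
  · rintro ⟨v, ⟨a, ha⟩, hv⟩
    rw [maximalMinors_le_iff]
    intro c
    rw [← Ideal.Quotient.eq_zero_iff_mem, RingHom.map_det, ← exists_vecMul_eq_zero_iff]
    refine ⟨fun a ↦ Ideal.Quotient.mk Q (v a), Function.ne_iff.mpr ⟨a, ?_⟩, funext fun b ↦ ?_⟩
    · simpa [Ideal.Quotient.eq_zero_iff_mem] using ha
    · simpa [vecMul, dotProduct] using Ideal.Quotient.eq_zero_iff_mem.mpr (hv (c b))

/-- The Schur complement of the entry `(a, b)`, multiplied by that entry. -/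
def pivot (H : Matrix (Fin (m + 1)) (Fin (n + 1)) A) (a : Fin (m + 1)) (b : Fin (n + 1)) :
    Matrix (Fin m) (Fin n) A :=
  of fun s t ↦ H a b * H (a.succAbove s) (b.succAbove t)
    - H (a.succAbove s) b * H a (b.succAbove t)

theorem maximalMinors_pivot_le_iff {Q : Ideal A} [Q.IsPrime]
    {H : Matrix (Fin (m + 1)) (Fin (n + 1)) A} {a : Fin (m + 1)} {b : Fin (n + 1)}
    (h : H a b ∉ Q) : (H.pivot a b).maximalMinors ≤ Q ↔ H.maximalMinors ≤ Q := by
  rw [maximalMinors_le_iff_exists, maximalMinors_le_iff_exists]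
  constructor
  · rintro ⟨v, ⟨s, hs⟩, hv⟩
    refine ⟨a.insertNth (-∑ s, v s * H (a.succAbove s) b) fun s ↦ H a b * v s,
      ⟨a.succAbove s, ?_⟩, fun j ↦ ?_⟩
    · rw [Fin.insertNth_apply_succAbove]
      exact Ideal.IsPrime.mul_notMem inferInstance h hs
    · rw [Fin.sum_univ_succAbove _ a]
      simp only [Fin.insertNth_apply_same, Fin.insertNth_apply_succAbove]
      obtain rfl | ⟨t, rfl⟩ := Fin.eq_self_or_eq_succAbove b j
      · convert Q.zero_mem
        rw [neg_mul, Finset.sum_mul, neg_add_eq_zero]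
        exact Finset.sum_congr rfl fun s _ ↦ by ring
      · convert hv t using 1
        rw [neg_mul, Finset.sum_mul, neg_add_eq_sub, ← Finset.sum_sub_distrib]
        exact Finset.sum_congr rfl fun s _ ↦ by simp only [pivot, of_apply]; ring
  · rintro ⟨v, ⟨i, hi⟩, hv⟩
    have hb := hv b
    rw [Fin.sum_univ_succAbove _ a] at hb
    refine ⟨fun s ↦ v (a.succAbove s), ?_, fun t ↦ ?_⟩
    · by_contra! hmem
      have hva : v a ∈ Q := by
        have := (Q.add_mem_iff_left (sum_mem fun s _ ↦ Q.mul_mem_right _ (hmem s))).mp hb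
        exact (Ideal.IsPrime.mem_or_mem inferInstance this).resolve_right h
      obtain rfl | ⟨s, rfl⟩ := Fin.eq_self_or_eq_succAbove a i
      exacts [hi hva, hi (hmem s)]
    · have ht := hv (b.succAbove t)
      rw [Fin.sum_univ_succAbove _ a] at ht
      convert Q.sub_mem (Q.mul_mem_left (H a b) ht) (Q.mul_mem_left (H a (b.succAbove t)) hb)
        using 1
      rw [mul_add, mul_add, Finset.mul_sum, Finset.mul_sum, add_sub_add_comm,
        ← Finset.sum_sub_distrib, ← add_zero (Finset.sum _ _), add_comm]
      congr 1
      · ring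
      · exact Finset.sum_congr rfl fun s _ ↦ by simp only [pivot, of_apply]; ring

theorem mem_minimalPrimes_maximalMinors_pivot {P : Ideal A}
    {H : Matrix (Fin (m + 1)) (Fin (n + 1)) A} {a : Fin (m + 1)} {b : Fin (n + 1)}
    (h : H a b ∉ P) (hP : P ∈ H.maximalMinors.minimalPrimes) :
    P ∈ (H.pivot a b).maximalMinors.minimalPrimes := by
  have := hP.isPrime
  refine ⟨⟨this, (maximalMinors_pivot_le_iff h).mpr hP.1.2⟩, fun Q ⟨hQ, hHQ⟩ hQP ↦ ?_⟩
  exact hP.2 ⟨hQ, (maximalMinors_pivot_le_iff fun h' ↦ h (hQP h')).mp hHQ⟩ hQP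

end Matrix

theorem Ideal.comap_constantCoeff_mem_minimalPrimes_sup_span_X {A : Type*} [CommRing A]
    {I P : Ideal A} {J : Ideal (Polynomial A)} (hJ : J.map Polynomial.constantCoeff = I)
    (hP : P ∈ I.minimalPrimes) :
    P.comap Polynomial.constantCoeff ∈ (J ⊔ Ideal.span {Polynomial.X}).minimalPrimes := by
  have := hP.isPrime
  refine ⟨⟨inferInstance, sup_le ?_ ?_⟩, fun N ⟨hN, hJN⟩ hNP f hf ↦ ?_⟩
  · rw [← Ideal.map_le_iff_le_comap, hJ]
    exact hP.1.2
  · simp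
  · have hX : Polynomial.X ∈ N := hJN (Ideal.mem_sup_right (Ideal.mem_span_singleton_self _))
    have hsub : ∀ g : Polynomial A, g - Polynomial.C (Polynomial.constantCoeff g) ∈ N := fun g ↦ by
      rw [Polynomial.constantCoeff_apply, ← Polynomial.divX_mul_X_add g]
      simpa using N.mul_mem_left _ hX
    have hmem : ∀ g : Polynomial A, Polynomial.C (Polynomial.constantCoeff g) ∈ N ↔ g ∈ N :=
      fun g ↦ (N.add_mem_iff_right (hsub g)).symm.trans (by rw [sub_add_cancel])
    have hle : P ≤ N.comap Polynomial.C := by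
      refine hP.2 ⟨inferInstance, ?_⟩ fun x hx ↦ by simpa using hNP hx
      rw [← hJ, Ideal.map_le_iff_le_comap]
      intro g hg
      exact (hmem g).mpr (hJN (Ideal.mem_sup_left hg))
    exact (hmem f).mp (hle hf)

theorem Ideal.map_C_mem_minimalPrimes {A : Type*} [CommRing A] [IsNoetherianRing A]
    {I P : Ideal A} {J : Ideal (Polynomial A)} (hJ : J.map Polynomial.constantCoeff = I)
    (hP : P ∈ I.minimalPrimes) (hJP : J ≤ P.map Polynomial.C) :
    P.map Polynomial.C ∈ J.minimalPrimes := by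
  have := hP.isPrime
  refine ⟨⟨inferInstance, hJP⟩, fun Q ⟨hQ, hJQ⟩ hQP ↦ ?_⟩
  by_contra hlt
  set N : Ideal (Polynomial A) := P.comap Polynomial.constantCoeff
  have hPN : P.map Polynomial.C ≤ N := by
    rw [Ideal.map_le_iff_le_comap]
    intro x hx
    simpa [N] using hx
  have hXN : Polynomial.X ∈ N := by simp [N]
  have hXP : Polynomial.X ∉ P.map Polynomial.C := fun h ↦ by
    simpa [(Ideal.ne_top_iff_one P).mp this.ne_top] using Ideal.mem_map_C_iff.mp h 1
  have hN : N ∈ (Q ⊔ Ideal.span {Polynomial.X}).minimalPrimes := by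
    have hJN := comap_constantCoeff_mem_minimalPrimes_sup_span_X hJ hP
    refine ⟨⟨hJN.isPrime, sup_le (hQP.trans hPN) ?_⟩, fun N' ⟨hN', hQN'⟩ h ↦ ?_⟩
    · rwa [Ideal.span_singleton_le_iff_mem]
    · exact hJN.2 ⟨hN', (sup_le_sup_right hJQ _).trans hQN'⟩ h
  have hone := Ideal.map_height_le_one_of_mem_minimalPrimes hN
  have hker : RingHom.ker (Ideal.Quotient.mk Q) = Q := Ideal.mk_ker
  have h₁ : (P.map Polynomial.C).map (Ideal.Quotient.mk Q) < N.map (Ideal.Quotient.mk Q) := by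
    refine lt_of_le_of_ne (Ideal.map_mono hPN) fun h ↦ hXP ?_
    have := congrArg (Ideal.comap (Ideal.Quotient.mk Q)) h
    rw [Ideal.comap_map_quotientMk, Ideal.comap_map_quotientMk, sup_eq_right.mpr hQP,
      sup_eq_right.mpr (hQP.trans hPN)] at this
    exact this ▸ hXN
  have : ((P.map Polynomial.C).map (Ideal.Quotient.mk Q)).IsPrime :=
    Ideal.isPrime_map_quotientMk_of_isPrime hQP
  have : N.IsPrime := hN.isPrime
  have : (N.map (Ideal.Quotient.mk Q)).IsPrime :=
    Ideal.isPrime_map_quotientMk_of_isPrime (hQP.trans hPN)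
  have h₂ := (Ideal.height_add_one_le_of_lt_of_isPrime h₁).trans hone
  have h₃ : ((P.map Polynomial.C).map (Ideal.Quotient.mk Q)).height = 0 := by
    rw [← nonpos_iff_eq_zero]
    exact (ENat.add_le_add_iff_right ENat.one_ne_top).mp (by rwa [zero_add])
  rw [Ideal.height_eq_zero_iff_eq_bot, Ideal.map_eq_bot_iff_le_ker, hker] at h₃
  exact hlt h₃

theorem Ideal.height_le_height_map_C {A : Type*} [CommRing A] (P : Ideal A) [P.IsPrime] :
    P.height ≤ (P.map Polynomial.C).height := by
  have hmono : StrictMono fun p : PrimeSpectrum A ↦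
      (⟨p.asIdeal.map Polynomial.C, inferInstance⟩ : PrimeSpectrum (Polynomial A)) := by
    refine Monotone.strictMono_of_injective (fun p q h ↦ Ideal.map_mono h) fun p q h ↦ ?_
    ext1
    have h' := congrArg (fun r ↦ r.asIdeal.comap Polynomial.C) h
    have key (I : Ideal A) : (I.map Polynomial.C).comap Polynomial.C = I := by
      ext x
      refine ⟨fun h ↦ ?_, fun h ↦ Ideal.mem_map_of_mem _ h⟩
      simpa using Ideal.mem_map_C_iff.mp h 0
    simpa only [key] using h'
  have := Order.height_le_height_apply_of_strictMono _ hmono ⟨P, inferInstance⟩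
  rwa [← PrimeSpectrum.height_eq_orderHeight, ← PrimeSpectrum.height_eq_orderHeight] at this

/-- **Macaulay's bound** on the height of the ideal of maximal minors of an `m × (m + 1)` matrix. -/
theorem Matrix.height_le_two_of_mem_minimalPrimes_maximalMinors {m : ℕ} {A : Type*} [CommRing A]
    [IsNoetherianRing A] (H : Matrix (Fin m) (Fin (m + 1)) A) {P : Ideal A}
    (hP : P ∈ H.maximalMinors.minimalPrimes) : P.height ≤ 2 := by
  induction m generalizing A with
  | zero =>
    have h1 := maximalMinors_le_iff.mp hP.1.2 Fin.elim0
    rw [det_isEmpty] at h1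
    exact absurd ((Ideal.eq_top_iff_one P).mpr h1) hP.isPrime.ne_top
  | succ m ih =>
    by_cases hH : ∃ a b, H a b ∉ P
    · obtain ⟨a, b, hab⟩ := hH
      exact ih (H.pivot a b) (mem_minimalPrimes_maximalMinors_pivot hab hP)
    push Not at hH
    have hPprime := hP.isPrime
    cases m with
    | zero =>
      have hspan : H.maximalMinors ≤ Ideal.span (Set.range (H 0)) := by
        rw [maximalMinors_le_iff]
        intro c
        rw [det_fin_one]
        exact Ideal.subset_span ⟨c 0, rfl⟩
      have hmin : P ∈ (Ideal.span (Set.range (H 0))).minimalPrimes := by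
        refine ⟨⟨hPprime, Ideal.span_le.mpr (Set.range_subset_iff.mpr (hH 0))⟩, fun Q hQ hQP ↦ ?_⟩
        exact hP.2 ⟨hQ.1, hspan.trans hQ.2⟩ hQP
      refine (Ideal.height_le_card_of_mem_minimalPrimes_span (Set.finite_range _) hmin).trans ?_
      rw [← Set.image_univ]
      exact_mod_cast (Set.ncard_image_le Set.finite_univ).trans (by simp)
    | succ m =>
      set M : Matrix (Fin (m + 2)) (Fin (m + 3)) (Polynomial A) :=
        H.map Polynomial.C + single 0 0 Polynomial.X with hM
      have hM0 : M.map Polynomial.constantCoeff = H := by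
        ext a b
        by_cases h : 0 = a ∧ 0 = b <;> simp [hM, h]
      have hJ : M.maximalMinors.map Polynomial.constantCoeff = H.maximalMinors := by
        rw [← maximalMinors_map, hM0]
      have hMP : M.maximalMinors ≤ P.map Polynomial.C := by
        rw [maximalMinors_le_iff_exists]
        refine ⟨Pi.single 1 1, ⟨1, ?_⟩, fun b ↦ ?_⟩
        · simpa using (Ideal.ne_top_iff_one _).mp (inferInstance : (P.map Polynomial.C).IsPrime).ne_top
        · simpa [Pi.single_apply, hM, single_apply] using Ideal.mem_map_of_mem Polynomial.C (hH 1 b)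
      have hM00 : M 0 0 ∉ P.map Polynomial.C := fun h ↦ by
        simpa [hM, Polynomial.coeff_C, (Ideal.ne_top_iff_one P).mp hPprime.ne_top] using
          Ideal.mem_map_C_iff.mp h 1
      exact P.height_le_height_map_C.trans <| ih (M.pivot 0 0) <|
        mem_minimalPrimes_maximalMinors_pivot hM00 (Ideal.map_C_mem_minimalPrimes hJ hP hMP)

theorem Matrix.height_le_height_map_maximalMinors_add_two {m : ℕ} {A : Type*} [CommRing A]
    [IsNoetherianRing A] (H : Matrix (Fin m) (Fin (m + 1)) A) {P : Ideal A} [P.IsPrime]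
    (hP : H.maximalMinors ≤ P) :
    P.height ≤ (P.map (Ideal.Quotient.mk H.maximalMinors)).height + 2 := by
  classical
  have : (P.map (Ideal.Quotient.mk H.maximalMinors)).IsPrime :=
    Ideal.isPrime_map_quotientMk_of_isPrime hP
  obtain ⟨s, hs, hcard⟩ := Ideal.exists_finset_card_eq_height_of_isNoetherianRing
    (P.map (Ideal.Quotient.mk H.maximalMinors))
  have hsurj : Set.SurjOn (Ideal.Quotient.mk H.maximalMinors) P s := by
    intro x hx
    obtain ⟨y, rfl⟩ := Ideal.Quotient.mk_surjective x
    have := hs.1.2 (Ideal.subset_span hx)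
    exact ⟨y, by simpa [hP, sup_of_le_left] using this, rfl⟩
  obtain ⟨t, htP, hts, himg⟩ := s.exists_subset_injOn_image_eq_of_surjOn (P : Set A) hsurj
  have hmin : P ∈ (H.maximalMinors ⊔ Ideal.span (t : Set A)).minimalPrimes := by
    refine Ideal.mem_minimalPrimes_sup hP ?_
    convert! hs
    simp [Ideal.map_span, ← himg]
  have htP' : Ideal.span (t : Set A) ≤ P := Ideal.span_le.mpr htP
  have hmin' : P.map (Ideal.Quotient.mk (Ideal.span (t : Set A))) ∈
      (H.map (Ideal.Quotient.mk (Ideal.span (t : Set A)))).maximalMinors.minimalPrimes := by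
    rw [maximalMinors_map]
    refine ⟨⟨Ideal.isPrime_map_quotientMk_of_isPrime htP', Ideal.map_mono hP⟩,
      fun Q ⟨hQ, hHQ⟩ hQP ↦ ?_⟩
    rw [Ideal.map_le_iff_le_comap] at hHQ ⊢
    have htQ : Ideal.span (t : Set A) ≤ Q.comap (Ideal.Quotient.mk _) := by
      rw [← Ideal.map_le_iff_le_comap, Ideal.map_quotient_self]
      exact bot_le
    refine hmin.2 ⟨inferInstance, sup_le hHQ htQ⟩ ?_
    have := Ideal.comap_mono (f := Ideal.Quotient.mk (Ideal.span (t : Set A))) hQP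
    rwa [Ideal.comap_map_quotientMk, sup_eq_right.mpr htP'] at this
  calc P.height ≤ _ + (t : Set A).encard := Ideal.height_le_height_add_encard_of_subset _ htP
    _ ≤ 2 + (t : Set A).encard := by
        gcongr
        exact height_le_two_of_mem_minimalPrimes_maximalMinors _ hmin'
    _ = _ := by
        rw [add_comm, ← hcard, Set.encard_coe_eq_coe_finsetCard, ← himg,
          Finset.card_image_of_injOn hts]

namespace MvPolynomial

attribute [local instance] gradedAlgebra

theorem homogeneousComponent_mul_of_isHomogeneous {σ A : Type*} [CommRing A]
    {g : MvPolynomial σ A} {e : ℕ} (hg : g.IsHomogeneous e) (h : MvPolynomial σ A) (d : ℕ) :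
    homogeneousComponent d (h * g) = if e ≤ d then homogeneousComponent (d - e) h * g else 0 := by
  rw [← decomposition.decompose'_apply, ← decomposition.decompose'_apply]
  exact DirectSum.coe_decompose_mul_of_right_mem (homogeneousSubmodule σ A) d hg

theorem exists_isHomogeneous_sum_mul_eq {ι σ A : Type*} [CommRing A] {g : ι → MvPolynomial σ A}
    {e : ι → ℕ} {s : Finset ι} (hg : ∀ j ∈ s, (g j).IsHomogeneous (e j)) {p : MvPolynomial σ A}
    {d : ℕ} (hp : p.IsHomogeneous d) (hpg : p ∈ Ideal.span (g '' s)) :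
    ∃ h : ι → MvPolynomial σ A, (∀ j, (h j).IsHomogeneous (d - e j)) ∧
      (∀ j, d < e j → h j = 0) ∧ p = ∑ j ∈ s, h j * g j := by
  obtain ⟨c, hc⟩ := (Submodule.mem_span_image_finset_iff_exists_fun' _).mp hpg
  refine ⟨fun j ↦ if e j ≤ d then homogeneousComponent (d - e j) (c j) else 0, fun j ↦ ?_,
    fun j hj ↦ if_neg (not_le.mpr hj), ?_⟩
  · dsimp only
    split_ifs
    · exact homogeneousComponent_isHomogeneous _ _
    · exact isHomogeneous_zero _ _ _
  · rw [← homogeneousComponent_eq_self hp, ← hc, map_sum]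
    refine Finset.sum_congr rfl fun j hj ↦ ?_
    rw [smul_eq_mul, homogeneousComponent_mul_of_isHomogeneous (hg j hj), ite_mul, zero_mul]

theorem IsHomogeneous.constantCoeff_eq_zero {σ A : Type*} [CommSemiring A]
    {p : MvPolynomial σ A} {d : ℕ} (hp : p.IsHomogeneous d) (hd : d ≠ 0) :
    constantCoeff p = 0 :=
  hp.coeff_eq_zero (by simpa using hd.symm)

theorem le_ker_constantCoeff_of_mem_minimalPrimes {σ K : Type*} [Field K]
    {I P : Ideal (MvPolynomial σ K)} (hI : I.IsHomogeneous (homogeneousSubmodule σ K))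
    (hP : P ∈ I.minimalPrimes) : P ≤ RingHom.ker (constantCoeff : MvPolynomial σ K →+* K) := by
  have hprime := hP.isPrime
  set Q := P.homogeneousCore (homogeneousSubmodule σ K)
  have hQ : P ≤ Q.toIdeal :=
    hP.2 ⟨hprime.homogeneousCore, hI.toIdeal_homogeneousCore_eq_self.ge.trans
      (Ideal.homogeneousCore_mono _ hP.1.2)⟩
      (Ideal.toIdeal_homogeneousCore_le _ _)
  intro p hp
  by_contra hne
  refine hprime.ne_top (Ideal.eq_top_of_isUnit_mem P ?_ ((IsUnit.mk0 _ hne).map C))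
  have := homogeneousComponent_mem_of_mem Q.isHomogeneous (hQ hp) 0
  rw [homogeneousComponent_zero] at this
  exact Ideal.toIdeal_homogeneousCore_le _ _ this

theorem isHomogeneous_span_image {ι σ A : Type*} [CommRing A] {g : ι → MvPolynomial σ A}
    {e : ι → ℕ} {s : Set ι} (hg : ∀ j ∈ s, (g j).IsHomogeneous (e j)) :
    (Ideal.span (g '' s)).IsHomogeneous (homogeneousSubmodule σ A) := by
  refine Ideal.homogeneous_span _ _ ?_
  rintro _ ⟨j, hj, rfl⟩
  exact ⟨e j, hg j hj⟩

instance isMaximal_ker_constantCoeff {σ K : Type*} [Field K] :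
    (RingHom.ker (constantCoeff : MvPolynomial σ K →+* K)).IsMaximal :=
  RingHom.ker_isMaximal_of_surjective _ fun a ↦ ⟨C a, constantCoeff_C _ a⟩

end MvPolynomial

theorem ringKrullDim_quotient_le_ringKrullDim_quotient_sup_add_card (K : Type*) {A : Type*}
    [Field K] [CommRing A] [Algebra K A] [Algebra.FiniteType K A] {I M : Ideal A} [M.IsMaximal]
    (hIM : I ≤ M) (hM : ∀ p ∈ I.minimalPrimes, p ≤ M) {s : Finset A} (hs : (s : Set A) ⊆ M) :
    ringKrullDim (A ⧸ I) ≤ ringKrullDim (A ⧸ I ⊔ Ideal.span (s : Set A)) + s.card := by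
  classical
  have : IsNoetherianRing A := Algebra.FiniteType.isNoetherianRing K A
  set π := Ideal.Quotient.mk I
  have hN : (M.map π).IsMaximal :=
    .map_of_surjective_of_ker_le Ideal.Quotient.mk_surjective (by simpa [π] using hIM)
  have hmin : ∀ p ∈ minimalPrimes (A ⧸ I), p ≤ M.map π := fun p hp ↦ by
    rw [← Ideal.map_comap_of_surjective π Ideal.Quotient.mk_surjective p]
    refine Ideal.map_mono (hM _ ?_)
    rw [Ideal.minimalPrimes_eq_comap]
    exact ⟨p, hp, rfl⟩
  set t : Finset (A ⧸ I) := s.image π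
  have ht : (t : Set (A ⧸ I)) ⊆ M.map π := by
    simpa [t, Set.subset_def] using fun x hx ↦ Ideal.mem_map_of_mem π (hs hx)
  have htM : Ideal.span (t : Set (A ⧸ I)) ≤ M.map π := Ideal.span_le.mpr ht
  have hne : (M.map π).map (Ideal.Quotient.mk (Ideal.span (t : Set (A ⧸ I)))) ≠ ⊤ :=
    (Ideal.isPrime_map_quotientMk_of_isPrime htM).ne_top
  have hcard : (t : Set (A ⧸ I)).encard ≤ s.card := by
    rw [Set.encard_coe_eq_coe_finsetCard]
    exact_mod_cast Finset.card_image_le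
  have hle : I ⊔ Ideal.span (s : Set A) ≤
      RingHom.ker ((Ideal.Quotient.mk (Ideal.span (t : Set (A ⧸ I)))).comp π) := by
    refine sup_le (fun x hx ↦ ?_) (Ideal.span_le.mpr fun x hx ↦ ?_)
    · simp [RingHom.mem_ker, π, Ideal.Quotient.eq_zero_iff_mem.mpr hx]
    · exact Ideal.Quotient.eq_zero_iff_mem.mpr
        (Ideal.subset_span (Finset.mem_coe.mpr (Finset.mem_image_of_mem π hx)))
  have hdim := ringKrullDim_le_of_surjective (Ideal.Quotient.lift _ _ hle)
    (Ideal.Quotient.lift_surjective_of_surjective _ hle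
      (Ideal.Quotient.mk_surjective.comp Ideal.Quotient.mk_surjective))
  have hht := Ideal.height_le_height_add_encard_of_subset (t : Set (A ⧸ I)) ht
  calc ringKrullDim (A ⧸ I) ≤ (M.map π).height := ringKrullDim_le_height_of_minimalPrimes_le K _ hmin
    _ ≤ (((M.map π).map (Ideal.Quotient.mk (Ideal.span (t : Set (A ⧸ I))))).height + s.card : ℕ∞) := by
        exact_mod_cast hht.trans (by gcongr)
    _ ≤ _ := by
        push_cast
        gcongr
        exact (Ideal.height_le_ringKrullDim_of_ne_top hne).trans hdim

theorem card_le_ringKrullDim_quotient_singularIdeal_add {n s : ℕ}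
    {p : ℕ → MvPolynomial (Fin (n + 1)) ℂ} {q : Fin (s + 1) → MvPolynomial (Fin (n + 1)) ℂ}
    {H : Matrix (Fin s) (Fin (s + 1)) (MvPolynomial (Fin (n + 1)) ℂ)}
    (hp : ∀ l : Fin s, p (l.1 + 1) = ∑ j, H l j * q j) (hq : ∀ j, constantCoeff (q j) = 0)
    (hH : H.maximalMinors ≤ RingHom.ker constantCoeff) :
    ((n + 1 : ℕ) : WithBot ℕ∞) ≤
      ringKrullDim (MvPolynomial (Fin (n + 1)) ℂ ⧸ singularIdeal n s p) + (s + 3 : ℕ) := by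
  set M : Ideal (MvPolynomial (Fin (n + 1)) ℂ) := RingHom.ker constantCoeff
  have hqM : Set.range q ⊆ M := Set.range_subset_iff.mpr hq
  set J := Ideal.span (Set.range q)
  have hJM : J ≤ M := Ideal.span_le.mpr hqM
  set π := Ideal.Quotient.mk J
  have hπq : ∀ j, π (q j) = 0 := fun j ↦
    Ideal.Quotient.eq_zero_iff_mem.mpr (Ideal.subset_span ⟨j, rfl⟩)
  have hN : (M.map π).IsPrime := Ideal.isPrime_map_quotientMk_of_isPrime hJM
  have hHM : (H.map π).maximalMinors ≤ M.map π := by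
    rw [Matrix.maximalMinors_map]
    exact Ideal.map_mono hH
  set ρ := Ideal.Quotient.mk (H.map π).maximalMinors
  have hne : (M.map π).map ρ ≠ ⊤ := (Ideal.isPrime_map_quotientMk_of_isPrime hHM).ne_top
  have hle : singularIdeal n s p ≤ RingHom.ker (ρ.comp π) := by
    refine Ideal.span_le.mpr (Set.union_subset ?_ ?_)
    · rintro _ ⟨l, hl, rfl⟩
      obtain ⟨l, rfl⟩ := Nat.exists_eq_add_of_le' hl.1
      have := hp ⟨l, hl.2⟩
      simp only at this
      simp [this, hπq]
    · rintro _ ⟨c, rfl⟩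
      have hmul : (Matrix.of fun l l' : Fin s ↦ pderiv (c l') (p (l.1 + 1))).map π =
          H.map π * Matrix.of fun j l' ↦ π (pderiv (c l') (q j)) := by
        ext l l'
        simp [hp, Matrix.mul_apply, hπq, Derivation.leibniz]
      refine Ideal.Quotient.eq_zero_iff_mem.mpr ?_
      rw [RingHom.map_det, RingHom.mapMatrix_apply, hmul]
      exact Matrix.det_mul_mem_maximalMinors _ _
  have hdim := ringKrullDim_le_of_surjective (Ideal.Quotient.lift _ _ hle)
    (Ideal.Quotient.lift_surjective_of_surjective _ hle
      (Ideal.Quotient.mk_surjective.comp Ideal.Quotient.mk_surjective))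
  have hcard : (Set.range q).encard ≤ (s + 1 : ℕ) := by
    rw [← Set.image_univ]
    exact (Set.encard_image_le _ _).trans (by simp)
  have h₁ := Ideal.height_le_height_add_encard_of_subset _ hqM
  have h₂ := Matrix.height_le_height_map_maximalMinors_add_two (H.map π) hHM
  have h₃ : M.height ≤ ((M.map π).map ρ).height + (s + 3 : ℕ) := by
    refine h₁.trans ((add_le_add h₂ hcard).trans ?_)
    rw [add_assoc]
    gcongr
    exact_mod_cast (by omega)
  rw [mvPolynomial_height_of_isMaximal] at h₃
  calc ((n + 1 : ℕ) : WithBot ℕ∞) ≤ (((M.map π).map ρ).height + (s + 3 : ℕ) : ℕ∞) := by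
        exact_mod_cast h₃
    _ ≤ _ := by
        rw [WithBot.coe_add]
        exact add_le_add_left ((Ideal.height_le_ringKrullDim_of_ne_top hne).trans hdim) _

theorem Monotone.exists_eq_comp_succAbove {α : Type*} [LinearOrder α] {n : ℕ} {a : Fin n → α}
    {b : Fin (n + 1) → α} (ha : Monotone a) (hb : Monotone b) {τ : Fin n → Fin (n + 1)}
    (hτ : Function.Injective τ) (h : a = b ∘ τ) : ∃ p : Fin (n + 1), a = b ∘ p.succAbove := by
  obtain ⟨p, hp⟩ : ∃ p, ∀ x, τ x ≠ p := by
    by_contra! hsurj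
    simpa using Fintype.card_le_of_surjective τ hsurj
  choose π hπ using fun x ↦ Fin.exists_succAbove_eq (hp x)
  have hπinj : Function.Injective π := fun x y hxy ↦ hτ (by rw [← hπ x, ← hπ y, hxy])
  have hab : a = (b ∘ p.succAbove) ∘ Equiv.ofBijective π hπinj.bijective_of_finite := by
    ext x
    simp [h, hπ]
  refine ⟨p, ?_⟩
  have hmono : Monotone ((b ∘ p.succAbove) ∘ Equiv.refl _) :=
    hb.comp p.strictMono_succAbove.monotone
  exact hab.trans (Tuple.unique_monotone (hab ▸ ha) hmono)

theorem stmt_13 (k : ℕ) (hk : 2 ≤ k)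
    (f g : ℕ → MvPolynomial (Fin (k + 4)) ℂ) (df dg : ℕ → ℕ)
    (hf0 : ∀ i, 1 ≤ i → i ≤ k → f i ≠ 0)
    (hg0 : ∀ j, 1 ≤ j → j ≤ k + 1 → g j ≠ 0)
    (hfh : ∀ i, 1 ≤ i → i ≤ k → (f i).IsHomogeneous (df i))
    (hgh : ∀ j, 1 ≤ j → j ≤ k + 1 → (g j).IsHomogeneous (dg j))
    (hdfpos : ∀ i, 1 ≤ i → i ≤ k → 0 < df i)
    (hdgpos : ∀ j, 1 ≤ j → j ≤ k + 1 → 0 < dg j)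
    (hdfmono : ∀ i j, 1 ≤ i → i ≤ j → j ≤ k → df i ≤ df j)
    (hdgmono : ∀ i j, 1 ≤ i → i ≤ j → j ≤ k + 1 → dg i ≤ dg j)
    -- (i) ⟨f_1,…,f_k⟩ ⊆ ⟨g_1,…,g_{k+1}⟩
    (hsub : Ideal.span (f '' Set.Icc 1 k) ≤ Ideal.span (g '' Set.Icc 1 (k + 1)))
    -- (ii) X = V(f_1,…,f_k) has dimension 3 and finitely many singular points
    (hXdim : ringKrullDim
        (MvPolynomial (Fin (k + 4)) ℂ ⧸ Ideal.span (f '' Set.Icc 1 k)) = 4)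
    (hXsing : (projSingularLocus (k + 3) k f).Finite)
    -- (iii) S = V(g_1,…,g_{k+1}) is a smooth surface
    (hSdim : ringKrullDim
        (MvPolynomial (Fin (k + 4)) ℂ ⧸ Ideal.span (g '' Set.Icc 1 (k + 1))) = 3)
    (hSsmooth : ∀ x : Fin (k + 4) → ℂ, x ≠ 0 →
      (∀ j, 1 ≤ j → j ≤ k + 1 → eval x (g j) = 0) →
      (jacobianAt (k + 3) (k + 1) g x).rank = k + 1)
    -- (iv) V(f_1,…,f_s) is smooth in codimension 3 for every s ≤ k−1
    (hcodim : ∀ s, 1 ≤ s → s ≤ k - 1 → SmoothInCodimThree (k + 3) s f)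
    (i : ℕ) (hi1 : 1 ≤ i) (hik : i ≤ k - 1) (hlt : df i < dg (i + 2)) :
    -- (deg f_1,…,deg f_i) is obtained from (deg g_1,…,deg g_{i+1}) by deleting one entry
    ∃ m, 1 ≤ m ∧ m ≤ i + 1 ∧
      ∀ j, 1 ≤ j → j ≤ i → df j = if j < m then dg j else dg (j + 1) := by
  set M : Ideal (MvPolynomial (Fin (k + 4)) ℂ) := RingHom.ker constantCoeff
  have hfM : ∀ l, 1 ≤ l → l ≤ k → f l ∈ M := fun l h1 hl ↦
    (hfh l h1 hl).constantCoeff_eq_zero (hdfpos l h1 hl).ne'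
  have hrow : ∀ s : Fin i, ∃ h : Fin (i + 1) → MvPolynomial (Fin (k + 4)) ℂ,
      (∀ j, (h j).IsHomogeneous (df (s + 1) - dg (j + 1))) ∧
      (∀ j : Fin (i + 1), df (s + 1) < dg (j + 1) → h j = 0) ∧ f (s + 1) = ∑ j, h j * g (j + 1) := by
    intro s
    have hmem : f (s + 1) ∈ Ideal.span (g '' (Finset.Icc 1 (k + 1) : Finset ℕ)) := by
      rw [Finset.coe_Icc]
      exact hsub (Ideal.subset_span ⟨_, ⟨by omega, by omega⟩, rfl⟩)
    obtain ⟨h, hh, h0, hsum⟩ := exists_isHomogeneous_sum_mul_eq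
      (fun j hj ↦ hgh j (Finset.mem_Icc.mp hj).1 (Finset.mem_Icc.mp hj).2)
      (hfh (s + 1) (by omega) (by omega)) hmem
    refine ⟨fun j ↦ h (j + 1), fun j ↦ hh _, fun j ↦ h0 _, ?_⟩
    rw [hsum, Fin.sum_univ_eq_sum_range (fun j ↦ h (j + 1) * g (j + 1)),
      Finset.range_eq_Ico, Finset.sum_Ico_add' (fun j ↦ h j * g j), zero_add]
    refine (Finset.sum_subset (fun j ↦ by grind) fun j hj hj' ↦ ?_).symm
    rw [Finset.mem_Icc] at hj
    rw [Finset.mem_Ico] at hj'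
    rw [h0 j, zero_mul]
    calc df (s + 1) ≤ df i := hdfmono _ _ (by omega) (by omega) (by omega)
      _ < dg (i + 2) := hlt
      _ ≤ dg j := hdgmono _ _ (by omega) (by omega) hj.2
  choose H hHdeg hH0 hHf using hrow
  have hnot : ¬ Matrix.maximalMinors (Matrix.of H) ≤ M := by
    intro hle
    have hlower := card_le_ringKrullDim_quotient_singularIdeal_add (H := Matrix.of H)
      (q := fun j ↦ g (j + 1)) hHf (fun j ↦ (hgh _ (by omega) (by omega)).constantCoeff_eq_zero
        (hdgpos _ (by omega) (by omega)).ne') hle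
    classical
    set s : Finset (MvPolynomial (Fin (k + 4)) ℂ) := (Finset.Icc (i + 1) k).image f
    have hupper := ringKrullDim_quotient_le_ringKrullDim_quotient_sup_add_card ℂ
      (I := Ideal.span (f '' Set.Icc 1 i)) (M := M) (s := s)
      (Ideal.span_le.mpr (Set.image_subset_iff.mpr fun l hl ↦ hfM l hl.1 (by grind)))
      (fun P hP ↦ le_ker_constantCoeff_of_mem_minimalPrimes
        (isHomogeneous_span_image fun l hl ↦ hfh l hl.1 (by grind)) hP)
      (by
        rw [Finset.coe_image, Set.image_subset_iff]
        exact fun l hl ↦ hfM l (by grind) (by grind))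
    have hunion : Set.Icc 1 i ∪ Set.Icc (i + 1) k = Set.Icc 1 k := by
      ext l
      grind
    rw [Finset.coe_image, Finset.coe_Icc, ← Ideal.span_union, ← Set.image_union, hunion,
      hXdim] at hupper
    have hcard : s.card ≤ k - i := Finset.card_image_le.trans (by simp)
    have hsmooth := (hcodim i hi1 hik).trans hupper
    have hsum : ((k + 3 + 1 : ℕ) : WithBot ℕ∞) + 4 ≤ 4 + s.card + (i + 3 : ℕ) :=
      calc _ ≤ _ + ((i + 3 : ℕ) : WithBot ℕ∞) + 4 := add_le_add_left hlower 4
        _ = _ := add_right_comm _ _ _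
        _ ≤ _ := add_le_add_left hsmooth _
    norm_cast at hsum
    omega
  rw [Matrix.maximalMinors_le_iff] at hnot
  push Not at hnot
  obtain ⟨c, hc⟩ := hnot
  have hdet : (((Matrix.of H).submatrix id c).map constantCoeff).det ≠ 0 := by
    rwa [← RingHom.mapMatrix_apply, ← RingHom.map_det]
  have hcinj : Function.Injective c := by
    intro a b hab
    by_contra hne
    exact hdet (Matrix.det_zero_of_column_eq hne fun l ↦ by simp [hab])
  obtain ⟨σ, hσ⟩ : ∃ σ : Equiv.Perm (Fin i), ∀ s, constantCoeff (H (σ s) (c s)) ≠ 0 := by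
    by_contra! hall
    refine hdet ?_
    rw [Matrix.det_apply]
    refine Finset.sum_eq_zero fun σ _ ↦ ?_
    obtain ⟨s, hs⟩ := hall σ
    rw [Finset.prod_eq_zero (Finset.mem_univ s) hs, smul_zero]
  have hdeg : ∀ s, df (σ s + 1) = dg (c s + 1) := by
    intro s
    refine le_antisymm ?_ (not_lt.mp fun h ↦ hσ s (by rw [hH0 _ _ h, map_zero]))
    by_contra! h
    exact hσ s ((hHdeg _ _).constantCoeff_eq_zero (by omega))
  obtain ⟨p, hp⟩ := Monotone.exists_eq_comp_succAbove (a := fun s : Fin i ↦ df (s + 1))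
    (b := fun j : Fin (i + 1) ↦ dg (j + 1)) (τ := c ∘ σ.symm)
    (fun a b h ↦ hdfmono _ _ (by omega) (by simpa using h) (by omega))
    (fun a b h ↦ hdgmono _ _ (by omega) (by simpa using h) (by omega))
    (hcinj.comp σ.symm.injective) (by ext s; simp [← hdeg])
  refine ⟨p + 1, by omega, by omega, fun j hj1 hji ↦ ?_⟩
  obtain ⟨j, rfl⟩ := Nat.exists_eq_add_of_le' hj1
  have := congrFun hp ⟨j, hji⟩
  simp only [Function.comp_apply, Fin.succAbove, Fin.lt_def, Fin.val_castSucc] at this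
  rw [this]
  split_ifs <;> first | rfl | omega
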